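/- Loop-erased λ-LWW is purely repulsive: let λ = (λ_η) be nonnegative loop activities satisfying the symmetry assumption and z ≥ 0. If η₁ is a self-avoiding walk ending at a vertex y, η₂ is a self-avoiding walk beginning at y, and the concatenation η = η₁∘η₂ is self-avoiding, then w̄_{λ,z}(η) = z^{|η₁|}·z^{|η₂|}·exp(μ_{λ,z}(range(η₁)))·exp(μ_{λ,z}(range(η₂); range(η₁))), and consequently w̄_{λ,z}(η₁∘η₂) ≤ w̄_{λ,z}(η₁)·w̄_{λ,z}(η₂) (identities and inequality in [0,∞]). -/

import Mathlib

open scoped ENNReal NNReal BigOperators Classical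

noncomputable section

namespace LWW

/-- A point of the lattice ℤ^d. -/
abbrev Pt (d : ℕ) := Fin d → ℤ

/-- ℓ¹ distance on ℤ^d. -/
def dist1 {d : ℕ} (x y : Pt d) : ℕ := ∑ i, (x i - y i).natAbs

/-- Nearest-neighbour adjacency on ℤ^d. -/
def Adj {d : ℕ} (x y : Pt d) : Prop := dist1 x y = 1

/-- Auxiliary function for single loop erasure: scan the list, keeping the
self-avoiding prefix `pre`; when the first repeated vertex is met, return the
loop-erased list together with the removed loop. -/
def le1Aux {α : Type*} [DecidableEq α] : List α → List α → List α × Option (List α)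
  | pre, [] => (pre, none)
  | pre, x :: rest =>
    if x ∈ pre then
      (pre.takeWhile (fun y => y ≠ x) ++ x :: rest,
        some (pre.dropWhile (fun y => y ≠ x) ++ [x]))
    else le1Aux (pre ++ [x]) rest

/-- Single loop erasure LE¹. -/
def LE1 {α : Type*} [DecidableEq α] (l : List α) : List α := (le1Aux [] l).1

/-- The loop removed by a single loop erasure (if the list is not self-avoiding). -/
def removedLoop {α : Type*} [DecidableEq α] (l : List α) : Option (List α) := (le1Aux [] l).2

/-- Iterate single loop erasure (with fuel), collecting the multiset of removed loops. -/
def leAux {α : Type*} [DecidableEq α] : ℕ → List α → List α × Multiset (List α)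
  | 0, l => (l, 0)
  | n + 1, l =>
    match le1Aux ([] : List α) l with
    | (_, none) => (l, 0)
    | (l', some c) => ((leAux n l').1, c ::ₘ (leAux n l').2)

/-- Loop erasure LE. -/
def LE {α : Type*} [DecidableEq α] (l : List α) : List α := (leAux l.length l).1

/-- The multiset of loops removed by loop erasure. -/
def erasedLoops {α : Type*} [DecidableEq α] (l : List α) : Multiset (List α) :=
  (leAux l.length l).2

/-- The number of loops removed by loop erasure. -/
def nLoops {α : Type*} [DecidableEq α] (l : List α) : ℕ := Multiset.card (erasedLoops l)

/-- A (finite) nearest-neighbour walk on ℤ^d, recorded as its (nonempty) list of vertices. -/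
structure Walk (d : ℕ) where
  pts : List (Pt d)
  ne : pts ≠ []
  chain : pts.Chain' Adj

namespace Walk

variable {d : ℕ}

/-- The number of steps of a walk. -/
def len (ω : Walk d) : ℕ := ω.pts.length - 1

/-- The initial vertex of a walk. -/
def start (ω : Walk d) : Pt d := ω.pts.headI

/-- The final vertex of a walk. -/
def finish (ω : Walk d) : Pt d := ω.pts.getLastD default

/-- The range (set of visited vertices) of a walk. -/
def range (ω : Walk d) : Set (Pt d) := {x | x ∈ ω.pts}

/-- The `i`-th vertex of a walk. -/
def nth (ω : Walk d) (i : ℕ) : Pt d := ω.pts.getD i default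

/-- A walk is a loop if it has at least one step and ends where it began. -/
def IsLoop (ω : Walk d) : Prop := 1 ≤ ω.len ∧ ω.finish = ω.start

end Walk

/-- The list of vertices of a self-avoiding polygon: a closed nearest-neighbour
walk all of whose vertices are distinct except that the last equals the first. -/
def IsSAPList {d : ℕ} (l : List (Pt d)) : Prop :=
  l.Chain' Adj ∧ 3 ≤ l.length ∧ l.getLastD default = l.headI ∧ l.dropLast.Nodup

/-- Change the initial vertex of a polygon list by a cyclic rotation. -/
def polyRot {d : ℕ} (l : List (Pt d)) (r : ℕ) : List (Pt d) :=
  l.dropLast.rotate r ++ [(l.dropLast.rotate r).headI]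

/-- An isometry of the lattice ℤ^d: a bijection preserving ℓ¹ distance. -/
def IsLatticeIso {d : ℕ} (R : Pt d ≃ Pt d) : Prop :=
  ∀ x y : Pt d, dist1 (R x) (R y) = dist1 x y

/-- The symmetry assumption on the loop activities: invariance under isometries of ℤ^d
and under change of initial vertex and of orientation of the polygon. -/
def SymmAssumption {d : ℕ} (lam : List (Pt d) → ℝ≥0) : Prop :=
  (∀ R : Pt d ≃ Pt d, IsLatticeIso R → ∀ l : List (Pt d), IsSAPList l →
      lam (l.map R) = lam l) ∧
  (∀ l : List (Pt d), IsSAPList l → ∀ r : ℕ, lam (polyRot l r) = lam l) ∧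
  (∀ l : List (Pt d), IsSAPList l → lam l.reverse = lam l)

/-- The boundedness assumption: sup over self-avoiding polygons of the activity is finite. -/
def BoundedAssumption {d : ℕ} (lam : List (Pt d) → ℝ≥0) : Prop :=
  ∃ M : ℝ≥0, ∀ l : List (Pt d), IsSAPList l → lam l ≤ M

/-- The product of the loop activities over the loops erased from `ω`, i.e. λ^{n_L(ω)}. -/
def wt0 {d : ℕ} (lam : List (Pt d) → ℝ≥0) (ω : Walk d) : ℝ≥0∞ :=
  ((erasedLoops ω.pts).map (fun η => (lam η : ℝ≥0∞))).prod

/-- The λ-LWW weight w_{λ,z}(ω) = z^{|ω|} λ^{n_L(ω)}. -/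
def wt {d : ℕ} (lam : List (Pt d) → ℝ≥0) (z : ℝ≥0) (ω : Walk d) : ℝ≥0∞ :=
  (z : ℝ≥0∞) ^ ω.len * wt0 lam ω

/-- The λ-LWW two-point function. -/
def G {d : ℕ} (lam : List (Pt d) → ℝ≥0) (z : ℝ≥0) (x y : Pt d) : ℝ≥0∞ :=
  ∑' ω : Walk d, if ω.start = x ∧ ω.finish = y then wt lam z ω else 0

/-- The λ-LWW loop measure μ_{λ,z}(A;B). -/
def mu {d : ℕ} (lam : List (Pt d) → ℝ≥0) (z : ℝ≥0) (A B : Set (Pt d)) : ℝ≥0∞ :=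
  ∑' ω : Walk d,
    if ω.IsLoop ∧ (ω.range ∩ A).Nonempty ∧ ω.range ∩ B = ∅
    then wt lam z ω / (ω.len : ℝ≥0∞) else 0

/-- The generalized λ-LWW loop measure μ_{λ,z}(A,B;C) with two hitting sets. -/
def mu2 {d : ℕ} (lam : List (Pt d) → ℝ≥0) (z : ℝ≥0) (A B C : Set (Pt d)) : ℝ≥0∞ :=
  ∑' ω : Walk d,
    if ω.IsLoop ∧ (ω.range ∩ A).Nonempty ∧ (ω.range ∩ B).Nonempty ∧ ω.range ∩ C = ∅
    then wt lam z ω / (ω.len : ℝ≥0∞) else 0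

/-- exp : [0,∞] → [0,∞] with exp(∞) = ∞. -/
def eexp (x : ℝ≥0∞) : ℝ≥0∞ := if x = ⊤ then ⊤ else ENNReal.ofReal (Real.exp x.toReal)

/-- The loop-erased λ-LWW weight w̄_{λ,z}(η) of a self-avoiding walk η. -/
def wbar {d : ℕ} (lam : List (Pt d) → ℝ≥0) (z : ℝ≥0) (η : Walk d) : ℝ≥0∞ :=
  ∑' ω : Walk d, if LE ω.pts = η.pts then wt lam z ω else 0

/-- c_n^λ : the total λ-LWW mass of n-step walks started at the origin. -/
def cN {d : ℕ} (lam : List (Pt d) → ℝ≥0) (n : ℕ) : ℝ≥0∞ :=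
  ∑' ω : Walk d, if ω.start = 0 ∧ ω.len = n then wt0 lam ω else 0

/-- The susceptibility χ_λ(z) = Σ_n c_n^λ z^n. -/
def chi {d : ℕ} (lam : List (Pt d) → ℝ≥0) (z : ℝ) : ℝ≥0∞ :=
  ∑' n : ℕ, cN lam n * ENNReal.ofReal z ^ n

/-- The critical point z_c(λ): the radius of convergence of the susceptibility
(for a power series with nonnegative coefficients this is the supremum of the
set of nonnegative z at which the series converges). -/
def zc {d : ℕ} (lam : List (Pt d) → ℝ≥0) : ℝ :=
  sSup {z : ℝ | 0 ≤ z ∧ chi lam z < ⊤}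

/-- The sum, over all set partitions of `S`, of the product over the blocks of the weights `V`. -/
def partitionSum {α R : Type*} [DecidableEq α] [CommRing R] (V : Finset α → R)
    (S : Finset α) : R :=
  if h : S.Nonempty then
    ∑ T ∈ (S.erase h.choose).powerset,
      V (insert h.choose T) * partitionSum V (S.erase h.choose \ T)
  else 1
termination_by S.card
decreasing_by
  exact lt_of_le_of_lt (Finset.card_le_card Finset.sdiff_subset)
    (Finset.card_erase_lt_of_mem h.choose_spec)

section PartitionSum

variable {α R : Type*} [DecidableEq α] [CommRing R]

theorem partitionSum_empty (V : Finset α → R) : partitionSum V ∅ = 1 := by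
  rw [partitionSum]; simp

theorem partitionSum_insert (V : Finset α → R) (S : Finset α) :
    ∀ x P, x ∉ P → S = insert x P →
      partitionSum V S = ∑ T ∈ P.powerset, V (insert x T) * partitionSum V (P \ T) := by
  induction S using Finset.strongInduction with
  | H S ih =>
  have key : ∀ x y P, x ∉ P → y ∉ P → x ≠ y → S = insert x (insert y P) →
      ∑ T ∈ (insert y P).powerset, V (insert x T) * partitionSum V (insert y P \ T) =
      (∑ T ∈ P.powerset, ∑ U ∈ (P \ T).powerset,
        V (insert x T) * (V (insert y U) * partitionSum V ((P \ T) \ U))) +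
      ∑ T ∈ P.powerset, V (insert x (insert y T)) * partitionSum V (P \ T) := by
    intro x y P hx hy hxy hS
    rw [Finset.sum_powerset_insert hy]
    congr 1
    · refine Finset.sum_congr rfl fun T hT => ?_
      rw [Finset.mem_powerset] at hT
      have hyT : y ∉ T := fun h => hy (hT h)
      rw [Finset.insert_sdiff_of_notMem _ hyT, ← Finset.mul_sum]
      rw [ih (insert y (P \ T)) ?_ y (P \ T) (by simp [hy]) rfl]
      refine ⟨?_, fun h => ?_⟩
      · rw [hS]
        exact (Finset.insert_subset_insert _ Finset.sdiff_subset).trans (Finset.subset_insert _ _)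
      · have := h (show x ∈ S by rw [hS]; simp)
        simp [hxy, hx] at this
    · refine Finset.sum_congr rfl fun T hT => ?_
      rw [Finset.insert_sdiff_insert, Finset.sdiff_insert_of_notMem hy]
  intro y P hy hS
  have hne : S.Nonempty := ⟨y, by rw [hS]; simp⟩
  rw [partitionSum, dif_pos hne]
  have hxS := hne.choose_spec
  generalize hne.choose = x at hxS
  by_cases hxy : x = y
  · subst hxy
    rw [hS, Finset.erase_insert hy]
  have hxP : x ∈ P := by
    rw [hS] at hxS
    exact (Finset.mem_insert.1 hxS).resolve_left hxy
  obtain ⟨Q, hxQ, rfl⟩ : ∃ Q, x ∉ Q ∧ P = insert x Q :=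
    ⟨P.erase x, by simp, (Finset.insert_erase hxP).symm⟩
  have hyQ : y ∉ Q := fun h => hy (Finset.mem_insert_of_mem h)
  have hS' : S = insert x (insert y Q) := by rw [hS, Finset.insert_comm]
  have he : S.erase x = insert y Q := by
    rw [hS', Finset.erase_insert]
    simp [hxy, hxQ]
  rw [he, key x y Q hxQ hyQ hxy hS', key y x Q hyQ hxQ (Ne.symm hxy) hS]
  congr 1
  · rw [Finset.sum_comm' (t' := Q.powerset) (s' := fun U => (Q \ U).powerset)]
    · refine Finset.sum_congr rfl fun T _ => Finset.sum_congr rfl fun U _ => ?_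
      rw [sdiff_sdiff_left, sdiff_sdiff_left, sup_comm]
      ring
    · intro T U
      simp only [Finset.mem_powerset, Finset.subset_sdiff]
      rw [disjoint_comm]; tauto
  · refine Finset.sum_congr rfl fun T _ => ?_
    rw [Finset.insert_comm]

theorem partitionSum_derivation {A : Type*} [CommSemiring A] [Algebra A R] (θ : Derivation A R R)
    (V : Finset α → R)
    (hV : ∀ T : Finset α, T.Nonempty → θ (V T) = T.card * V T - if T.card = 1 then 1 else 0)
    (S : Finset α) :
    S.card * partitionSum V S - θ (partitionSum V S) = ∑ y ∈ S, partitionSum V (S.erase y) := by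
  induction S using Finset.strongInduction with
  | H S ih =>
  rcases S.eq_empty_or_nonempty with rfl | ⟨x, hx⟩
  · simp [partitionSum_empty]
  obtain ⟨P, hxP, rfl⟩ : ∃ P, x ∉ P ∧ S = insert x P :=
    ⟨S.erase x, by simp, (Finset.insert_erase hx).symm⟩
  rw [Finset.sum_insert hxP, Finset.erase_insert hxP, partitionSum_insert V _ x P hxP rfl]
  have hterm : ∀ T ∈ P.powerset,
      ((insert x P).card : R) * (V (insert x T) * partitionSum V (P \ T))
        - θ (V (insert x T) * partitionSum V (P \ T)) =
      (if T = ∅ then partitionSum V (P \ T) else 0) +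
        ∑ y ∈ P \ T, V (insert x T) * partitionSum V ((P \ T).erase y) := by
    intro T hT
    rw [Finset.mem_powerset] at hT
    have hxT : x ∉ T := fun h => hxP (hT h)
    have hlt : P \ T ⊂ insert x P :=
      ⟨Finset.sdiff_subset.trans (Finset.subset_insert _ _), fun h => by
        have := h (Finset.mem_insert_self x P)
        simp [hxP] at this⟩
    rw [← Finset.mul_sum, ← ih _ hlt, Derivation.leibniz, hV _ ⟨x, by simp⟩]
    have h1 : (insert x T).card = T.card + 1 := Finset.card_insert_of_notMem hxT
    have h2 : (insert x P).card = (P \ T).card + T.card + 1 := by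
      rw [Finset.card_insert_of_notMem hxP, Finset.card_sdiff_add_card_eq_card hT]
    have h3 : (T.card + 1 = 1) ↔ T = ∅ := by simp
    rw [h1, h2]
    simp only [h3, smul_eq_mul]
    split_ifs <;> push_cast <;> ring
  rw [Finset.mul_sum, map_sum, ← Finset.sum_sub_distrib, Finset.sum_congr rfl hterm,
    Finset.sum_add_distrib, Finset.sum_ite_eq']
  simp only [Finset.empty_mem_powerset, if_true, Finset.sdiff_empty]
  congr 1
  rw [Finset.sum_comm' (t' := P) (s' := fun y => (P.erase y).powerset)]
  · refine Finset.sum_congr rfl fun y hy => ?_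
    have : (insert x P).erase y = insert x (P.erase y) := by
      rw [Finset.erase_insert_of_ne]
      rintro rfl
      exact hxP hy
    rw [this, partitionSum_insert V _ x (P.erase y) (by simp [hxP]) rfl]
    refine Finset.sum_congr rfl fun T _ => ?_
    rw [Finset.erase_sdiff_comm]
  · intro T y
    simp only [Finset.mem_powerset, Finset.mem_sdiff, Finset.subset_erase]
    tauto

theorem map_partitionSum_eq_one {B : Type*} [CommRing B] (f : R →+* B) (V : Finset α → R)
    (hV : ∀ T : Finset α, T.Nonempty → f (V T) = if T.card = 1 then 1 else 0) (S : Finset α) :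
    f (partitionSum V S) = 1 := by
  induction S using Finset.strongInduction with
  | H S ih =>
  rcases S.eq_empty_or_nonempty with rfl | ⟨x, hx⟩
  · simp [partitionSum_empty]
  obtain ⟨P, hxP, rfl⟩ : ∃ P, x ∉ P ∧ S = insert x P :=
    ⟨S.erase x, by simp, (Finset.insert_erase hx).symm⟩
  rw [partitionSum_insert V _ x P hxP rfl, map_sum, Finset.sum_eq_single ∅]
  · rw [map_mul, hV _ ⟨x, by simp⟩, Finset.sdiff_empty,
      ih P ⟨Finset.subset_insert _ _, fun h => hxP (h (Finset.mem_insert_self x P))⟩]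
    simp
  · intro T hT hT0
    have hxT : x ∉ T := fun h => hxP (Finset.mem_powerset.1 hT h)
    rw [map_mul, hV _ ⟨x, by simp⟩, Finset.card_insert_of_notMem hxT, if_neg, zero_mul]
    simpa using hT0
  · simp

end PartitionSum

section Exponential

open PowerSeries

theorem natCast_mul_coeff_pow_succ {R : Type*} [CommSemiring R] (f : R⟦X⟧) (k n : ℕ) :
    (n : R) * coeff n (f ^ (k + 1)) =
      (k + 1 : ℕ) * ∑ p ∈ Finset.HasAntidiagonal.antidiagonal n,
        coeff p.1 (f ^ k) * (p.2 * coeff p.2 f) := by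
  have hθ : ∀ (g : R⟦X⟧) (n : ℕ), coeff n (X * d⁄dX R g) = n * coeff n g := by
    intro g n
    cases n with
    | zero => simp
    | succ n => rw [coeff_succ_X_mul, coeff_derivative, mul_comm]; push_cast; rfl
  rw [← hθ, Derivation.leibniz_pow]
  have : X * ((k + 1) • f ^ (k + 1 - 1) • d⁄dX R f) = (k + 1) • (f ^ k * (X * d⁄dX R f)) := by
    simp only [Nat.add_sub_cancel, smul_eq_mul, nsmul_eq_mul]; ring
  rw [this, map_nsmul, coeff_mul, nsmul_eq_mul]
  simp only [hθ]

theorem tsum_coeff_mul (f g : ℝ≥0∞⟦X⟧) :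
    ∑' n, coeff n (f * g) = (∑' n, coeff n f) * ∑' n, coeff n g := by
  rw [← ENNReal.tsum_mul_right]
  simp_rw [← ENNReal.tsum_mul_left]
  rw [← ENNReal.tsum_prod (f := fun i j => coeff i f * coeff j g),
    ← Finset.HasAntidiagonal.sigmaAntidiagonalEquivProd.tsum_eq, ENNReal.tsum_sigma']
  refine tsum_congr fun n => ?_
  rw [coeff_mul, ← Finset.tsum_subtype]
  rfl

theorem tsum_coeff_pow (f : ℝ≥0∞⟦X⟧) (k : ℕ) :
    ∑' n, coeff n (f ^ k) = (∑' n, coeff n f) ^ k := by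
  induction k with
  | zero =>
    rw [pow_zero, pow_zero, tsum_eq_single 0]
    · simp
    · intro n hn; simp [coeff_one, hn]
  | succ k ih => rw [pow_succ, tsum_coeff_mul, ih, pow_succ]

theorem eexp_eq_tsum (x : ℝ≥0∞) : eexp x = ∑' k : ℕ, x ^ k / (k.factorial : ℝ≥0∞) := by
  unfold eexp
  split_ifs with h
  · subst h
    symm
    rw [ENNReal.tsum_eq_top_of_eq_top ⟨1, by simp⟩]
  · lift x to ℝ≥0 using h
    rw [ENNReal.coe_toReal, Real.exp_eq_exp_ℝ, NormedSpace.exp_eq_tsum_div,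
      ENNReal.ofReal_tsum_of_nonneg (fun n => by positivity)
        (Real.summable_pow_div_factorial _)]
    refine tsum_congr fun k => ?_
    rw [ENNReal.ofReal_div_of_pos (by positivity), ENNReal.ofReal_pow (by positivity)]
    simp

/-- The recursion satisfied by the coefficients of an exponential determines its total mass. -/
theorem tsum_eq_eexp (q m : ℕ → ℝ≥0∞) (hq : q 0 = 1) (hm : m 0 = 0)
    (h : ∀ n : ℕ, (n : ℝ≥0∞) * q n = ∑ p ∈ Finset.HasAntidiagonal.antidiagonal n, q p.1 * m p.2) :
    ∑' n, q n = eexp (∑' n, m n / n) := by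
  set f : ℝ≥0∞⟦X⟧ := PowerSeries.mk fun n => m n / n with hf
  have hjm : ∀ j : ℕ, (j : ℝ≥0∞) * coeff j f = m j := by
    intro j
    rw [hf, coeff_mk]
    rcases Nat.eq_zero_or_pos j with rfl | hj
    · simp [hm]
    · exact ENNReal.mul_div_cancel (by exact_mod_cast hj.ne') (ENNReal.natCast_ne_top j)
  set q' : ℕ → ℝ≥0∞ := fun n => ∑' k : ℕ, coeff n (f ^ k) / (k.factorial : ℝ≥0∞) with hq'
  have h0 : q' 0 = 1 := by
    rw [hq']
    simp only
    rw [tsum_eq_single 0]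
    · simp
    · intro k hk
      simp [hf, hm, hk, coeff_zero_eq_constantCoeff]
  have hrec : ∀ n : ℕ, (n : ℝ≥0∞) * q' n =
      ∑ p ∈ Finset.HasAntidiagonal.antidiagonal n, q' p.1 * m p.2 := by
    intro n
    simp only [hq']
    rw [← ENNReal.tsum_mul_left, tsum_eq_zero_add' ENNReal.summable]
    have hz : (n : ℝ≥0∞) * (coeff n (f ^ 0) / ((0 : ℕ).factorial : ℝ≥0∞)) = 0 := by
      rcases Nat.eq_zero_or_pos n with rfl | hn
      · simp
      · simp [coeff_one, hn.ne']
    rw [hz, zero_add]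
    simp_rw [← ENNReal.tsum_mul_right]
    rw [← Summable.tsum_finsetSum (fun _ _ => ENNReal.summable)]
    refine tsum_congr fun k => ?_
    rw [← mul_div_assoc, natCast_mul_coeff_pow_succ, Nat.factorial_succ]
    simp only [hjm]
    rw [Nat.cast_mul, ENNReal.mul_div_mul_left _ _ (by exact_mod_cast k.succ_ne_zero)
      (ENNReal.natCast_ne_top _), ENNReal.div_eq_inv_mul, Finset.mul_sum]
    refine Finset.sum_congr rfl fun p _ => ?_
    rw [ENNReal.div_eq_inv_mul, mul_assoc]
  have hqq : ∀ n, q n = q' n := by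
    intro n
    induction n using Nat.strong_induction_on with
    | _ n ih =>
    rcases Nat.eq_zero_or_pos n with rfl | hn
    · rw [hq, h0]
    have hne : (n : ℝ≥0∞) ≠ 0 := by exact_mod_cast hn.ne'
    rw [← ENNReal.mul_right_inj hne (ENNReal.natCast_ne_top n), h, hrec]
    refine Finset.sum_congr rfl fun p hp => ?_
    rw [Finset.HasAntidiagonal.mem_antidiagonal] at hp
    rcases Nat.eq_zero_or_pos p.2 with h2 | h2
    · rw [h2, hm, mul_zero, mul_zero]
    · rw [ih p.1 (by omega)]
  simp_rw [hqq, hq']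
  rw [ENNReal.tsum_comm, eexp_eq_tsum]
  refine tsum_congr fun k => ?_
  simp_rw [div_eq_mul_inv]
  rw [ENNReal.tsum_mul_right, tsum_coeff_pow, hf]
  simp [div_eq_mul_inv]

end Exponential

theorem nodup_concat {α : Type*} {σ : List α} (h : σ.Nodup) {x : α} (hx : x ∉ σ) :
    (σ ++ [x]).Nodup := by
  rw [← List.concat_eq_append]
  exact List.Nodup.concat hx h

section LoopErasure

variable {α : Type*} [DecidableEq α]

/-- The loop erasure of a walk extended by `x`, in terms of the loop erasure `σ` of the walk. -/
def leStep (σ : List α) (x : α) : List α :=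
  if x ∈ σ then σ.takeWhile (fun y => y ≠ x) ++ [x] else σ ++ [x]

/-- The loop, if any, erased when a walk with loop erasure `σ` is extended by `x`. -/
def leLoop (σ : List α) (x : α) : Multiset (List α) :=
  if x ∈ σ then {σ.dropWhile (fun y => y ≠ x) ++ [x]} else 0

theorem takeWhile_ne_append_cons {u p : List α} {x : α} (hx : x ∉ u) :
    (u ++ x :: p).takeWhile (fun y => y ≠ x) = u := by
  induction u with
  | nil => simp
  | cons a u ih =>
    rw [List.mem_cons, not_or] at hx
    rw [List.cons_append, List.takeWhile_cons, ih hx.2]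
    simp [Ne.symm hx.1]

theorem dropWhile_ne_append_cons {u p : List α} {x : α} (hx : x ∉ u) :
    (u ++ x :: p).dropWhile (fun y => y ≠ x) = x :: p := by
  induction u with
  | nil => simp
  | cons a u ih =>
    rw [List.mem_cons, not_or] at hx
    rw [List.cons_append, List.dropWhile_cons, ih hx.2]
    simp [Ne.symm hx.1]

theorem leStep_of_notMem {σ : List α} {x : α} (h : x ∉ σ) : leStep σ x = σ ++ [x] := if_neg h

theorem leLoop_of_notMem {σ : List α} {x : α} (h : x ∉ σ) : leLoop σ x = 0 := if_neg h

theorem leStep_append_cons {u p : List α} {x : α} (h : x ∉ u) :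
    leStep (u ++ x :: p) x = u ++ [x] := by
  rw [leStep, if_pos (by simp), takeWhile_ne_append_cons h]

theorem leLoop_append_cons {u p : List α} {x : α} (h : x ∉ u) :
    leLoop (u ++ x :: p) x = {x :: (p ++ [x])} := by
  rw [leLoop, if_pos (by simp), dropWhile_ne_append_cons h, List.cons_append]

theorem le1Aux_of_nodup (l pre : List α) (h : (pre ++ l).Nodup) :
    le1Aux pre l = (pre ++ l, none) := by
  induction l generalizing pre with
  | nil => simp [le1Aux]
  | cons x l ih =>
    have hx : x ∉ pre := fun hx => by
      rw [List.nodup_append] at h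
      exact h.2.2 x hx x (by simp) rfl
    rw [le1Aux, if_neg hx, ih _ (by simpa using h)]
    simp

theorem le1Aux_concat_of_nodup (l pre : List α) (x : α) (h : (pre ++ l).Nodup)
    (hx : x ∈ pre ++ l) :
    le1Aux pre (l ++ [x]) = ((pre ++ l).takeWhile (fun y => y ≠ x) ++ [x],
      some ((pre ++ l).dropWhile (fun y => y ≠ x) ++ [x])) := by
  induction l generalizing pre with
  | nil =>
    rw [List.append_nil] at hx
    simp [le1Aux, hx]
  | cons a l ih =>
    have ha : a ∉ pre := fun ha => by
      rw [List.nodup_append] at h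
      exact h.2.2 a ha a (by simp) rfl
    rw [List.cons_append, le1Aux, if_neg ha, ih _ (by simpa using h) (by simpa using hx)]
    simp

theorem le1Aux_of_not_nodup (l pre : List α) (hpre : pre.Nodup) (h : ¬ (pre ++ l).Nodup) :
    ∃ l' c, l'.length < (pre ++ l).length ∧ le1Aux pre l = (l', some c) ∧
      ∀ x, le1Aux pre (l ++ [x]) = (l' ++ [x], some c) := by
  induction l generalizing pre with
  | nil => simp [hpre] at h
  | cons a l ih =>
    by_cases ha : a ∈ pre
    · refine ⟨_, _, ?_, by rw [le1Aux, if_pos ha], fun x => ?_⟩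
      · obtain ⟨u, p, rfl, hu⟩ := List.eq_append_cons_of_mem ha
        rw [takeWhile_ne_append_cons hu]
        simp
      · rw [List.cons_append, le1Aux, if_pos ha]
        simp
    · have hp : (pre ++ [a]).Nodup := by
        rw [List.nodup_append]
        refine ⟨hpre, by simp, ?_⟩
        rintro b hb c hc rfl
        rw [List.mem_singleton] at hc
        exact ha (hc ▸ hb)
      obtain ⟨l', c, h1, h2, h3⟩ := ih (pre ++ [a]) hp (by simpa using h)
      refine ⟨l', c, by simpa using h1, by rw [le1Aux, if_neg ha, h2], fun x => ?_⟩
      rw [List.cons_append, le1Aux, if_neg ha, h3]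

theorem leAux_of_nodup (n : ℕ) {l : List α} (h : l.Nodup) : leAux n l = (l, 0) := by
  cases n with
  | zero => rfl
  | succ n => rw [leAux, le1Aux_of_nodup l [] (by simpa using h)]

theorem nodup_takeWhile_concat {σ : List α} (h : σ.Nodup) {x : α} (hx : x ∈ σ) :
    (σ.takeWhile (fun y => y ≠ x) ++ [x]).Nodup := by
  obtain ⟨u, p, rfl, hu⟩ := List.eq_append_cons_of_mem hx
  rw [takeWhile_ne_append_cons hu]
  refine List.Nodup.sublist ?_ h
  exact List.Sublist.append_left (by simp) u

theorem leAux_concat (n : ℕ) : ∀ (l : List α) (x : α) (m : ℕ), l.length ≤ n → l.length + 1 ≤ m →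
    leAux m (l ++ [x]) =
      (leStep (leAux n l).1 x, (leAux n l).2 + leLoop (leAux n l).1 x) := by
  induction n with
  | zero =>
    intro l x m hn _
    obtain rfl : l = [] := List.length_eq_zero_iff.1 (Nat.le_zero.1 hn)
    rw [leAux_of_nodup m (by simp), leAux_of_nodup 0 (by simp)]
    simp [leStep, leLoop]
  | succ n ih =>
    intro l x m hn hm
    obtain ⟨m, rfl⟩ : ∃ k, m = k + 1 := ⟨m - 1, by omega⟩
    by_cases h : l.Nodup
    · rw [leAux_of_nodup (n + 1) h]
      by_cases hx : x ∈ l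
      · rw [leAux, le1Aux_concat_of_nodup l [] x (by simpa using h) (by simpa using hx)]
        simp only [List.nil_append]
        rw [leAux_of_nodup m (nodup_takeWhile_concat h hx)]
        simp [leStep, leLoop, hx]
      · rw [leAux_of_nodup _ (nodup_concat h hx), leStep_of_notMem hx, leLoop_of_notMem hx]
        simp
    · obtain ⟨l', c, h1, h2, h3⟩ := le1Aux_of_not_nodup l [] (by simp) (by simpa using h)
      rw [List.nil_append] at h1
      rw [leAux, leAux, h2, h3]
      simp only
      rw [ih l' x m (by omega) (by omega)]
      simp

theorem LE_concat (l : List α) (x : α) : LE (l ++ [x]) = leStep (LE l) x := by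
  rw [LE, LE, leAux_concat l.length l x _ le_rfl (by simp)]

theorem erasedLoops_concat (l : List α) (x : α) :
    erasedLoops (l ++ [x]) = erasedLoops l + leLoop (LE l) x := by
  rw [erasedLoops, erasedLoops, LE, leAux_concat l.length l x _ le_rfl (by simp)]

theorem LE_nil : LE ([] : List α) = [] := rfl

theorem LE_singleton (x : α) : LE [x] = [x] := by
  rw [LE, leAux_of_nodup _ (by simp)]

theorem erasedLoops_singleton (x : α) : erasedLoops [x] = 0 := by
  rw [erasedLoops, leAux_of_nodup _ (by simp)]

theorem nodup_LE (l : List α) : (LE l).Nodup := by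
  induction l using List.reverseRecOn with
  | nil => simp [LE_nil]
  | append_singleton l x ih =>
    rw [LE_concat, leStep]
    split_ifs with hx
    · exact nodup_takeWhile_concat ih hx
    · exact nodup_concat ih hx

theorem LE_subset (l : List α) : LE l ⊆ l := by
  induction l using List.reverseRecOn with
  | nil => simp [LE_nil]
  | append_singleton l x ih =>
    rw [LE_concat, leStep]
    split_ifs with hx
    · exact List.append_subset_of_subset_of_subset
        (fun a ha => List.mem_append_left _ (ih ((List.takeWhile_subset _) ha))) (by simp)
    · exact List.append_subset_of_subset_of_subset
        (fun a ha => List.mem_append_left _ (ih ha)) (by simp)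

theorem getLast?_LE (l : List α) : (LE l).getLast? = l.getLast? := by
  induction l using List.reverseRecOn with
  | nil => simp [LE_nil]
  | append_singleton l x ih =>
    rw [LE_concat, leStep]
    split_ifs with hx <;> simp

theorem head?_LE (l : List α) : (LE l).head? = l.head? := by
  induction l using List.reverseRecOn with
  | nil => simp [LE_nil]
  | append_singleton l x ih =>
    rw [LE_concat]
    by_cases hx : x ∈ LE l
    · obtain ⟨u, p, hup, hu⟩ := List.eq_append_cons_of_mem hx
      have hl : l ≠ [] := by rintro rfl; simp [LE_nil] at hx
      rw [List.head?_append_of_ne_nil _ hl, ← ih, hup, leStep_append_cons hu]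
      cases u <;> simp
    · rw [leStep_of_notMem hx, List.head?_append, List.head?_append, ih]

theorem isChain_LE {r : α → α → Prop} {l : List α} (h : l.IsChain r) : (LE l).IsChain r := by
  induction l using List.reverseRecOn with
  | nil => simp [LE_nil]
  | append_singleton l x ih =>
    rw [List.isChain_append] at h
    rw [LE_concat]
    by_cases hx : x ∈ LE l
    · obtain ⟨u, p, hup, hu⟩ := List.eq_append_cons_of_mem hx
      have := ih h.1
      rw [hup] at this ⊢
      rw [leStep_append_cons hu]
      rw [List.append_cons] at this
      exact this.left_of_append
    · rw [leStep_of_notMem hx, List.isChain_append, getLast?_LE]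
      exact ⟨ih h.1, h.2⟩

theorem LE_eq_singleton_iff (l : List α) (y : α) :
    LE l = [y] ↔ l.head? = some y ∧ l.getLast? = some y := by
  rw [← head?_LE, ← getLast?_LE]
  have := nodup_LE l
  constructor
  · intro h; simp [h]
  · rintro ⟨h1, h2⟩
    generalize LE l = σ at *
    cases σ with
    | nil => simp at h1
    | cons a σ =>
      simp only [List.head?_cons, Option.some.injEq] at h1
      subst h1
      rcases σ.eq_nil_or_concat with rfl | ⟨τ, b, rfl⟩
      · rfl
      · rw [List.concat_eq_append, ← List.cons_append, List.getLast?_append] at h2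
        simp at h2
        subst h2
        simp at this

end LoopErasure

theorem tsum_list_eq_tsum_concat {α : Type*} (g : List α → ℝ≥0∞) (h : g [] = 0) :
    ∑' l, g l = ∑' l, ∑' x, g (l ++ [x]) := by
  rw [← ENNReal.tsum_prod (f := fun l x => g (l ++ [x]))]
  have hinj : Function.Injective fun q : List α × α => q.1 ++ [q.2] := by
    rintro ⟨l, x⟩ ⟨l', x'⟩ hq
    simpa using hq
  refine (hinj.tsum_eq (f := g) ?_).symm
  intro l hl
  rcases l.eq_nil_or_concat with rfl | ⟨l', x, rfl⟩
  · exact absurd h hl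
  · exact ⟨(l', x), by simp⟩

/-- The product of the activities of a multiset of loops. -/
def activity {α : Type*} (lam : List α → ℝ≥0) (m : Multiset (List α)) : ℝ≥0∞ :=
  (m.map fun η => (lam η : ℝ≥0∞)).prod

theorem activity_add {α : Type*} (lam : List α → ℝ≥0) (m m' : Multiset (List α)) :
    activity lam (m + m') = activity lam m * activity lam m' := by
  simp [activity]

/-- `l` is the list of vertices of an `n`-step walk inside `S`. -/
def IsWalkIn {α : Type*} (r : α → α → Prop) (S : Finset α) (n : ℕ) (l : List α) : Prop :=
  l.IsChain r ∧ l.length = n + 1 ∧ ∀ x ∈ l, x ∈ S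

theorem IsWalkIn.ne_nil {α : Type*} {r : α → α → Prop} {S : Finset α} {n : ℕ}
    {l : List α} (h : IsWalkIn r S n l) : l ≠ [] := by
  rintro rfl
  simp [IsWalkIn] at h

section WalkSum

variable {α : Type*} [DecidableEq α] (r : α → α → Prop) (lam : List α → ℝ≥0)

/-- The total activity of the `n`-step walks inside `S` with loop erasure `η`. -/
def walkSum (S : Finset α) (n : ℕ) (η : List α) : ℝ≥0∞ :=
  ∑' l : List α, if IsWalkIn r S n l ∧ LE l = η then activity lam (erasedLoops l) else 0

/-- `η` is the list of vertices of a self-avoiding walk inside `S`. -/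
structure IsSAWIn (S : Finset α) (η : List α) : Prop where
  ne_nil : η ≠ []
  nodup : η.Nodup
  isChain : η.IsChain r
  mem : ∀ x ∈ η, x ∈ S

variable {r lam}

theorem IsWalkIn.isSAWIn_LE {S : Finset α} {n : ℕ} {l : List α} (h : IsWalkIn r S n l) :
    IsSAWIn r S (LE l) := by
  refine ⟨fun h0 => ?_, nodup_LE l, isChain_LE h.1, fun x hx => h.2.2 x (LE_subset l hx)⟩
  have := head?_LE l
  rw [h0] at this
  simp only [List.head?_nil] at this
  exact h.ne_nil (List.head?_eq_none_iff.1 this.symm)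

theorem walkSum_eq_zero {S : Finset α} {n : ℕ} {η : List α} (h : ¬ IsSAWIn r S η) :
    walkSum r lam S n η = 0 := by
  rw [walkSum, ENNReal.tsum_eq_zero]
  intro l
  rw [if_neg]
  rintro ⟨h1, rfl⟩
  exact h h1.isSAWIn_LE

theorem walkSum_zero {S : Finset α} {η : List α} (h : IsSAWIn r S η) :
    walkSum r lam S 0 η = if η.length = 1 then 1 else 0 := by
  split_ifs with h1
  · obtain ⟨y, rfl⟩ := List.length_eq_one_iff.1 h1
    rw [walkSum, tsum_eq_single [y], if_pos, erasedLoops_singleton]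
    · simp [activity]
    · exact ⟨⟨h.isChain, by simp, h.mem⟩, LE_singleton y⟩
    · intro l hl
      rw [if_neg]
      rintro ⟨⟨-, h2, -⟩, h3⟩
      obtain ⟨x, rfl⟩ := List.length_eq_one_iff.1 h2
      rw [LE_singleton] at h3
      exact hl h3
  · rw [walkSum, ENNReal.tsum_eq_zero]
    intro l
    rw [if_neg]
    rintro ⟨⟨-, h2, -⟩, h3⟩
    obtain ⟨x, rfl⟩ := List.length_eq_one_iff.1 h2
    rw [LE_singleton] at h3
    exact h1 (by rw [← h3]; rfl)

theorem leStep_getLast? (σ : List α) (x : α) : (leStep σ x).getLast? = some x := by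
  rw [leStep]
  split_ifs <;> simp

theorem append_cons_inj_of_notMem {u v p q : List α} {y : α} (hu : y ∉ u) (hv : y ∉ v)
    (h : u ++ y :: p = v ++ y :: q) : u = v ∧ p = q := by
  have h1 := congrArg (List.takeWhile fun a => a ≠ y) h
  rw [takeWhile_ne_append_cons hu, takeWhile_ne_append_cons hv] at h1
  subst h1
  simpa using h

/-- Last-step decomposition of the walks with given loop erasure. -/
theorem walkSum_succ {S : Finset α} {n : ℕ} {η : List α} {y : α} (h : IsSAWIn r S (η ++ [y])) :
    walkSum r lam S (n + 1) (η ++ [y]) = (if η = [] then 0 else walkSum r lam S n η) +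
      ∑' p : List α, if (y :: (p ++ [y])).IsChain r then
        lam (y :: (p ++ [y])) * walkSum r lam S n (η ++ y :: p) else 0 := by
  have hyη : y ∉ η := fun hy => by
    have := h.nodup
    rw [List.nodup_append] at this
    exact this.2.2 y hy y (by simp) rfl
  have hyS : y ∈ S := h.mem y (by simp)
  have hR : (∑' p : List α, if (y :: (p ++ [y])).IsChain r then
        lam (y :: (p ++ [y])) * walkSum r lam S n (η ++ y :: p) else 0) =
      ∑' l : List α, ∑' p : List α, if (y :: (p ++ [y])).IsChain r ∧ IsWalkIn r S n l ∧
        LE l = η ++ y :: p then lam (y :: (p ++ [y])) * activity lam (erasedLoops l) else 0 := by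
    rw [ENNReal.tsum_comm]
    refine tsum_congr fun p => ?_
    by_cases hp : (y :: (p ++ [y])).IsChain r
    · simp only [hp, if_true, true_and]
      rw [walkSum, ← ENNReal.tsum_mul_left]
      refine tsum_congr fun l => ?_
      rw [mul_ite, mul_zero]
    · simp [hp]
  have hL : (if η = [] then 0 else walkSum r lam S n η) = ∑' l : List α,
      if IsWalkIn r S n l ∧ LE l = η then activity lam (erasedLoops l) else 0 := by
    split_ifs with h0
    · rw [← walkSum, walkSum_eq_zero]
      exact fun h1 => h1.ne_nil h0
    · rfl
  rw [hR, hL, ← ENNReal.tsum_add, walkSum, tsum_list_eq_tsum_concat _ (by simp [IsWalkIn])]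
  refine tsum_congr fun l => ?_
  rw [tsum_eq_single y]
  swap
  · intro x hx
    rw [if_neg]
    rintro ⟨-, h2⟩
    have := leStep_getLast? (LE l) x
    rw [← LE_concat, h2] at this
    simp at this
    exact hx this.symm
  rw [LE_concat, erasedLoops_concat, activity_add]
  have hwalk : IsWalkIn r S (n + 1) (l ++ [y]) ↔
      IsWalkIn r S n l ∧ ∀ b ∈ (LE l).getLast?, r b y := by
    rw [getLast?_LE]
    simp only [IsWalkIn, List.isChain_append, List.length_append, List.length_singleton,
      List.mem_append, List.mem_singleton, List.head?_cons, Option.mem_some_iff,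
      List.isChain_singleton, true_and, Nat.add_right_cancel_iff]
    constructor
    · rintro ⟨⟨h1, h2⟩, h3, h4⟩
      exact ⟨⟨h1, h3, fun x hx => h4 x (Or.inl hx)⟩, fun b hb => h2 b hb y rfl⟩
    · rintro ⟨⟨h1, h2, h3⟩, h4⟩
      refine ⟨⟨h1, ?_⟩, h2, ?_⟩
      · rintro b hb _ rfl
        exact h4 b hb
      · rintro x (hx | rfl)
        exacts [h3 x hx, hyS]
  by_cases hl : IsWalkIn r S n l
  swap
  · simp [hwalk, hl]
  have hσ := hl.isSAWIn_LE
  simp only [hwalk, hl, true_and]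
  generalize LE l = σ at hσ
  by_cases hy : y ∈ σ
  · obtain ⟨u, q, rfl, hu⟩ := List.eq_append_cons_of_mem hy
    rw [leStep_append_cons hu, leLoop_append_cons hu, if_neg (c := u ++ y :: q = η), zero_add]
    swap
    · rintro rfl
      simp at hyη
    have hch : (∀ b ∈ (u ++ y :: q).getLast?, r b y) ↔ (y :: (q ++ [y])).IsChain r := by
      rw [← List.cons_append, List.isChain_append]
      have := hσ.isChain.right_of_append
      rw [List.getLast?_append_of_ne_nil _ (by simp)]
      simp [this]
    by_cases hue : u = η
    · subst hue
      rw [tsum_eq_single q]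
      · simp only [hch]
        simp only [and_true, activity, Multiset.map_singleton, Multiset.prod_singleton]
        rw [mul_comm]
      · intro p hp
        rw [if_neg]
        rintro ⟨-, h2⟩
        exact hp (append_cons_inj_of_notMem hu hu h2).2.symm
    · rw [if_neg, eq_comm, ENNReal.tsum_eq_zero]
      · intro p
        rw [if_neg]
        rintro ⟨-, h2⟩
        exact hue (append_cons_inj_of_notMem hu hyη h2).1
      · rintro ⟨-, h2⟩
        exact hue (List.append_cancel_right h2)
  · rw [leStep_of_notMem hy, leLoop_of_notMem hy]
    have : (∑' p : List α, if (y :: (p ++ [y])).IsChain r ∧ σ = η ++ y :: p then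
        (lam (y :: (p ++ [y])) : ℝ≥0∞) * activity lam (erasedLoops l) else 0) = 0 := by
      rw [ENNReal.tsum_eq_zero]
      intro p
      rw [if_neg]
      rintro ⟨-, rfl⟩
      simp at hy
    rw [this, add_zero]
    by_cases hse : σ = η
    · subst hse
      have h1 := h.isChain
      rw [List.isChain_append] at h1
      rw [if_pos, if_pos rfl]
      · simp [activity]
      · exact ⟨fun b hb => h1.2.2 b hb y (by simp), rfl⟩
    · rw [if_neg, if_neg hse]
      rintro ⟨-, h2⟩
      exact hse (List.append_cancel_right h2)

end WalkSum

section FiniteVolume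

open PowerSeries

variable {α : Type*} [DecidableEq α] (r : α → α → Prop) (lam : List α → ℝ≥0)

/-- The orderings of a finite set. -/
def arrangements {α : Type*} [DecidableEq α] (T : Finset α) : Finset (List α) :=
  T.val.lists.toFinset

theorem mem_arrangements {α : Type*} [DecidableEq α] {T : Finset α} {p : List α} :
    p ∈ arrangements T ↔ T.val = (p : Multiset α) := by
  rw [arrangements, Multiset.mem_toFinset, Multiset.mem_lists_iff, Multiset.quot_mk_to_coe]

/-- The total activity of the polygons rooted at `y` whose remaining vertices form the set `T`. -/
def polygonSum (y : α) (T : Finset α) : ℝ :=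
  ∑ p ∈ arrangements T, if (y :: (p ++ [y])).IsChain r then (lam (y :: (p ++ [y])) : ℝ) else 0

/-- The generating function of the polygons with vertex set `T`. -/
def blockWeight (T : Finset α) : ℝ⟦X⟧ :=
  if h : T.Nonempty then
    C (polygonSum r lam h.choose (T.erase h.choose)) * X ^ T.card
  else 0

/-- The activities of polygons do not depend on the initial vertex. -/
def RotationInvariant : Prop :=
  ∀ (x y : α) (a b : List α), (x :: (a ++ y :: b)).Nodup →
    (x :: (a ++ y :: b ++ [x])).IsChain r →
      lam (y :: (b ++ x :: a ++ [y])) = lam (x :: (a ++ y :: b ++ [x]))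

/-- The alternating partition function: the signed sum over collections of disjoint polygons
in `S`. -/
def polygonXi (S : Finset α) : ℝ⟦X⟧ :=
  partitionSum (fun T => (if T.card = 1 then 1 else 0) - blockWeight r lam T) S

variable {r lam}

theorem isChain_rotate {α : Type*} {r : α → α → Prop} (x y : α) (a b : List α) :
    (y :: (b ++ x :: a ++ [y])).IsChain r ↔ (x :: (a ++ y :: b ++ [x])).IsChain r := by
  rw [← Cycle.chain_coe_cons, ← Cycle.chain_coe_cons]
  have : ((y :: (b ++ x :: a) : List α) : Cycle α) = (x :: (a ++ y :: b) : List α) := by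
    rw [Cycle.coe_eq_coe, ← List.cons_append, ← List.cons_append]
    exact List.isRotated_append
  rw [this]

theorem polygonSum_root (hrot : RotationInvariant r lam) {S : Finset α} {x y : α} (hx : x ∈ S)
    (hy : y ∈ S) : polygonSum r lam x (S.erase x) = polygonSum r lam y (S.erase y) := by
  by_cases hxy : x = y
  · rw [hxy]
  have hdec : ∀ x y : α, x ≠ y → y ∈ S → ∀ p ∈ arrangements (S.erase x),
      ∃ a b, p = a ++ y :: b ∧ (x :: (a ++ y :: b)).Nodup := by
    intro x y hxy hy p hp
    rw [mem_arrangements] at hp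
    have hyp : y ∈ p := by
      rw [← Multiset.mem_coe, ← hp, Finset.mem_val, Finset.mem_erase]
      exact ⟨Ne.symm hxy, hy⟩
    have hxp : x ∉ p := by
      rw [← Multiset.mem_coe, ← hp, Finset.mem_val]
      exact Finset.notMem_erase x S
    have hnd : p.Nodup := by
      rw [← Multiset.coe_nodup, ← hp]
      exact (S.erase x).nodup
    obtain ⟨a, b, rfl⟩ := List.append_of_mem hyp
    exact ⟨a, b, rfl, List.nodup_cons.2 ⟨hxp, hnd⟩⟩
  set φ : α → α → List α → List α := fun x y p =>
    (p.dropWhile (fun c => c ≠ y)).tail ++ x :: p.takeWhile (fun c => c ≠ y) with hφ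
  have hφ' : ∀ x y a b, (x :: (a ++ y :: b)).Nodup → φ x y (a ++ y :: b) = b ++ x :: a := by
    intro x y a b h
    have hya : y ∉ a := by
      simp only [List.nodup_cons, List.nodup_append] at h
      exact fun h' => h.2.2.2 y h' y (by simp) rfl
    simp only [hφ]
    rw [takeWhile_ne_append_cons hya, dropWhile_ne_append_cons hya, List.tail_cons]
  have hnd' : ∀ (x y : α) a b, (x :: (a ++ y :: b)).Nodup → (y :: (b ++ x :: a)).Nodup := by
    intro x y a b h
    refine (List.Perm.nodup_iff ?_).1 h
    rw [← List.cons_append, ← List.cons_append]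
    exact List.perm_append_comm
  have hmem : ∀ x y : α, x ≠ y → x ∈ S → y ∈ S → ∀ p ∈ arrangements (S.erase x),
      φ x y p ∈ arrangements (S.erase y) := by
    intro x y hxy hx hy p hp
    obtain ⟨a, b, rfl, hnd⟩ := hdec x y hxy hy p hp
    rw [hφ' x y a b hnd]
    rw [mem_arrangements] at hp ⊢
    rw [← Multiset.cons_inj_right y]
    rw [← Finset.cons_val (by simp), Finset.cons_eq_insert, Finset.insert_erase hy,
      Multiset.cons_coe]
    rw [← Multiset.cons_inj_right x] at hp
    rw [← Finset.cons_val (by simp), Finset.cons_eq_insert, Finset.insert_erase hx,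
      Multiset.cons_coe] at hp
    rw [hp, Multiset.coe_eq_coe, ← List.cons_append, ← List.cons_append]
    exact List.perm_append_comm
  have hinv : ∀ x y : α, x ≠ y → y ∈ S → ∀ p ∈ arrangements (S.erase x), φ y x (φ x y p) = p := by
    intro x y hxy hy p hp
    obtain ⟨a, b, rfl, hnd⟩ := hdec x y hxy hy p hp
    rw [hφ' x y a b hnd, hφ' y x b a (hnd' x y a b hnd)]
  refine Finset.sum_bij' (fun p _ => φ x y p) (fun p _ => φ y x p) (hmem x y hxy hx hy)
    (hmem y x (Ne.symm hxy) hy hx) (hinv x y hxy hy) (hinv y x (Ne.symm hxy) hx) ?_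
  intro p hp
  obtain ⟨a, b, rfl, hnd⟩ := hdec x y hxy hy p hp
  simp only [hφ' x y a b hnd, isChain_rotate x y a b]
  split_ifs with h
  · rw [hrot x y a b hnd h]
  · rfl

theorem blockWeight_insert (hrot : RotationInvariant r lam) {y : α} {T : Finset α} (hy : y ∉ T) :
    blockWeight r lam (insert y T) = C (polygonSum r lam y T) * X ^ (T.card + 1) := by
  have h : (insert y T).Nonempty := ⟨y, by simp⟩
  rw [blockWeight, dif_pos h, Finset.card_insert_of_notMem hy,
    polygonSum_root hrot h.choose_spec (Finset.mem_insert_self y T), Finset.erase_insert hy]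

theorem constantCoeff_polygonXi (S : Finset α) : constantCoeff (polygonXi r lam S) = 1 := by
  refine map_partitionSum_eq_one _ _ (fun T hT => ?_) S
  rw [blockWeight, dif_pos hT, map_sub, map_mul, map_pow, constantCoeff_X,
    zero_pow hT.card_pos.ne', mul_zero, sub_zero]
  split_ifs <;> simp

theorem polygonXi_mul_inv (S : Finset α) : polygonXi r lam S * (polygonXi r lam S)⁻¹ = 1 :=
  PowerSeries.mul_inv_cancel _ (by rw [constantCoeff_polygonXi]; exact one_ne_zero)

/-- The derivation `X · d/dX`. -/
def eulerDerivation : Derivation ℝ ℝ⟦X⟧ ℝ⟦X⟧ := (X : ℝ⟦X⟧) • d⁄dX ℝ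

theorem coeff_eulerDerivation (f : ℝ⟦X⟧) (n : ℕ) :
    coeff n (eulerDerivation f) = n * coeff n f := by
  change coeff n (X * d⁄dX ℝ f) = n * coeff n f
  cases n with
  | zero => simp
  | succ n => rw [coeff_succ_X_mul, coeff_derivative, mul_comm]; push_cast; rfl

theorem polygonXi_eulerDerivation (S : Finset α) :
    S.card * polygonXi r lam S - eulerDerivation (polygonXi r lam S) =
      ∑ y ∈ S, polygonXi r lam (S.erase y) := by
  refine partitionSum_derivation eulerDerivation _ (fun T hT => ?_) S
  rw [blockWeight, dif_pos hT]
  ext n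
  rw [coeff_eulerDerivation, ← map_natCast (C (R := ℝ)) T.card]
  simp only [map_sub, coeff_C_mul, coeff_X_pow]
  split_ifs with h1 h2 h2 <;> simp only [map_zero, coeff_one, h1, h2] <;>
    (try split_ifs) <;> simp_all

theorem polygonXi_insert (hrot : RotationInvariant r lam) {y : α} {P : Finset α} (hy : y ∉ P) :
    polygonXi r lam P = polygonXi r lam (insert y P) +
      ∑ T ∈ P.powerset, C (polygonSum r lam y T) * X ^ (T.card + 1) *
        polygonXi r lam (P \ T) := by
  have h := partitionSum_insert (fun T => (if T.card = 1 then 1 else 0) - blockWeight r lam T)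
    (insert y P) y P hy rfl
  have hterm : ∀ T ∈ P.powerset,
      ((if (insert y T).card = 1 then 1 else 0) - blockWeight r lam (insert y T)) *
        partitionSum (fun T => (if T.card = 1 then 1 else 0) - blockWeight r lam T) (P \ T) =
      (if T = ∅ then polygonXi r lam (P \ T) else 0) -
        C (polygonSum r lam y T) * X ^ (T.card + 1) * polygonXi r lam (P \ T) := by
    intro T hT
    have hyT : y ∉ T := fun h' => hy (Finset.mem_powerset.1 hT h')
    rw [blockWeight_insert hrot hyT, Finset.card_insert_of_notMem hyT, ← polygonXi, sub_mul,
      ite_mul, one_mul, zero_mul]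
    simp
  rw [Finset.sum_congr rfl hterm, Finset.sum_sub_distrib, Finset.sum_ite_eq',
    if_pos (Finset.empty_mem_powerset P), Finset.sdiff_empty, ← polygonXi] at h
  rw [h]
  ring

variable (r lam) in
/-- The generating function of the walks in `S` with loop erasure `η`. -/
def walkSeries (S : Finset α) (η : List α) : ℝ⟦X⟧ :=
  X ^ (η.length - 1) * (polygonXi r lam (S \ η.toFinset) * (polygonXi r lam S)⁻¹)

theorem walkSeries_concat (hrot : RotationInvariant r lam) {S : Finset α} {η : List α} {y : α}
    (h : IsSAWIn r S (η ++ [y])) :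
    walkSeries r lam S (η ++ [y]) = (if η = [] then 1 else X * walkSeries r lam S η) +
      X * ∑ T ∈ (S \ (η ++ [y]).toFinset).powerset, ∑ p ∈ arrangements T,
        if (y :: (p ++ [y])).IsChain r then
          C (lam (y :: (p ++ [y])) : ℝ) * walkSeries r lam S (η ++ y :: p) else 0 := by
  have hyη : y ∉ η := fun hy => by
    have := h.nodup
    rw [List.nodup_append] at this
    exact this.2.2 y hy y (by simp) rfl
  have hyS : y ∈ S := h.mem y (by simp)
  have hy : y ∉ S \ (η ++ [y]).toFinset := by simp
  have hins : insert y (S \ (η ++ [y]).toFinset) = S \ η.toFinset := by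
    ext x
    by_cases hxy : x = y
    · subst hxy; simp [hyS, hyη]
    · simp [hxy]
  have hT : ∀ T ∈ (S \ (η ++ [y]).toFinset).powerset, (∑ p ∈ arrangements T,
        if (y :: (p ++ [y])).IsChain r then
          C (lam (y :: (p ++ [y])) : ℝ) * walkSeries r lam S (η ++ y :: p) else 0) =
      C (polygonSum r lam y T) * (X ^ (η.length + T.card) *
        (polygonXi r lam ((S \ (η ++ [y]).toFinset) \ T) * (polygonXi r lam S)⁻¹)) := by
    intro T _
    rw [polygonSum, map_sum, Finset.sum_mul]
    refine Finset.sum_congr rfl fun p hp => ?_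
    rw [mem_arrangements] at hp
    have h1 : p.length = T.card := by rw [Finset.card, hp, Multiset.coe_card]
    have h2 : (S \ (η ++ [y]).toFinset) \ T = S \ (η ++ y :: p).toFinset := by
      ext x
      have : x ∈ T ↔ x ∈ p := by rw [← Finset.mem_val, hp, Multiset.mem_coe]
      simp only [Finset.mem_sdiff, this, List.mem_toFinset, List.mem_append, List.mem_cons]
      simp
      tauto
    split_ifs with hc
    · rw [walkSeries, h2, ← h1]
      have : (η ++ y :: p).length - 1 = η.length + p.length := by simp
      rw [this]
    · simp
  have hlen : (η ++ [y]).length - 1 = η.length := by simp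
  rw [Finset.sum_congr rfl hT, walkSeries, hlen, polygonXi_insert hrot hy, hins, add_mul, mul_add]
  congr 1
  · split_ifs with h0
    · subst h0
      simp [polygonXi_mul_inv]
    · have : η.length = η.length - 1 + 1 := by
        have := List.length_pos_iff.2 h0
        omega
      rw [walkSeries]
      nth_rewrite 1 [this]
      ring
  · rw [Finset.sum_mul, Finset.mul_sum, Finset.mul_sum]
    refine Finset.sum_congr rfl fun T _ => ?_
    ring

theorem tsum_list_eq_sum_lists (P : Finset α) (f : List α → ℝ≥0∞)
    (hf : ∀ p, f p ≠ 0 → p.Nodup ∧ ∀ x ∈ p, x ∈ P) :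
    ∑' p, f p = ∑ T ∈ P.powerset, ∑ p ∈ arrangements T, f p := by
  rw [← Finset.sum_biUnion]
  · refine tsum_eq_sum fun p hp => ?_
    by_contra h
    obtain ⟨h1, h2⟩ := hf p h
    refine hp (Finset.mem_biUnion.2 ⟨p.toFinset, ?_, ?_⟩)
    · rw [Finset.mem_powerset]
      intro x hx
      exact h2 x (List.mem_toFinset.1 hx)
    · rw [mem_arrangements, List.toFinset_val, h1.dedup]
  · intro T _ U _ hTU
    refine Finset.disjoint_left.2 fun p hp hp' => hTU ?_
    rw [mem_arrangements] at hp hp'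
    exact Finset.val_injective (hp.trans hp'.symm)

/-- In finite volume, the walks with loop erasure `η` are counted by a ratio of partition
functions. -/
theorem walkSum_eq_coeff (hrot : RotationInvariant r lam) (S : Finset α) (n : ℕ) :
    ∀ η, IsSAWIn r S η → walkSum r lam S n η = ENNReal.ofReal (coeff n (walkSeries r lam S η)) ∧
      0 ≤ coeff n (walkSeries r lam S η) := by
  induction n with
  | zero =>
    intro η h
    rw [walkSum_zero h]
    have hpos := List.length_pos_iff.2 h.ne_nil
    have : coeff 0 (walkSeries r lam S η) = if η.length = 1 then 1 else 0 := by
      have h1 : constantCoeff ((polygonXi r lam S)⁻¹) = (1 : ℝ) := by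
        have := congrArg constantCoeff (polygonXi_mul_inv (r := r) (lam := lam) S)
        rwa [map_mul, constantCoeff_polygonXi, one_mul, map_one] at this
      rw [walkSeries, coeff_zero_eq_constantCoeff, map_mul, map_mul, map_pow, constantCoeff_X,
        constantCoeff_polygonXi, h1]
      split_ifs with hl
      · simp [hl]
      · rw [zero_pow (by omega), zero_mul]
    rw [this]
    split_ifs <;> simp
  | succ n ih =>
    intro η h
    rcases η.eq_nil_or_concat with rfl | ⟨η, y, rfl⟩
    · exact absurd rfl h.ne_nil
    rw [List.concat_eq_append] at h ⊢
    set P := S \ (η ++ [y]).toFinset with hP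
    have hsaw : ∀ T ∈ P.powerset, ∀ p ∈ arrangements T, (y :: (p ++ [y])).IsChain r →
        IsSAWIn r S (η ++ y :: p) := by
      intro T hT p hp hc
      rw [mem_arrangements] at hp
      have hpP : ∀ x ∈ p, x ∈ S ∧ x ∉ η ++ [y] := by
        intro x hx
        have : x ∈ T := by rwa [← Finset.mem_val, hp, Multiset.mem_coe]
        have := Finset.mem_powerset.1 hT this
        rwa [hP, Finset.mem_sdiff, List.mem_toFinset] at this
      have hpn : p.Nodup := by
        rw [← Multiset.coe_nodup, ← hp]
        exact T.nodup
      rw [List.append_cons]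
      refine ⟨by simp, ?_, ?_, ?_⟩
      · rw [List.nodup_append]
        refine ⟨h.nodup, hpn, ?_⟩
        rintro a ha _ hb rfl
        exact (hpP a hb).2 ha
      · rw [List.append_assoc, List.isChain_append]
        have h1 := h.isChain
        rw [List.isChain_append] at h1
        rw [← List.cons_append] at hc
        exact ⟨h1.1, hc.left_of_append, fun x hx z hz => h1.2.2 x hx z (by simpa using hz)⟩
      · intro x hx
        rcases List.mem_append.1 hx with hx | hx
        exacts [h.mem x hx, (hpP x hx).1]
    have hsum : (∑' p : List α, if (y :: (p ++ [y])).IsChain r then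
        lam (y :: (p ++ [y])) * walkSum r lam S n (η ++ y :: p) else 0) =
        ∑ T ∈ P.powerset, ∑ p ∈ arrangements T, if (y :: (p ++ [y])).IsChain r then
        lam (y :: (p ++ [y])) * walkSum r lam S n (η ++ y :: p) else 0 := by
      refine tsum_list_eq_sum_lists P _ fun p hp => ?_
      have h1 : IsSAWIn r S (η ++ y :: p) := by
        by_contra hn
        rw [walkSum_eq_zero hn] at hp
        simp at hp
      have h2 := h1.nodup
      rw [List.append_cons, List.nodup_append] at h2
      refine ⟨h2.2.1, fun x hx => ?_⟩
      rw [hP, Finset.mem_sdiff, List.mem_toFinset]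
      exact ⟨h1.mem x (by simp [hx]), fun hx' => h2.2.2 x hx' x hx rfl⟩
    have hcoeff : coeff (n + 1) (walkSeries r lam S (η ++ [y])) =
        (if η = [] then 0 else coeff n (walkSeries r lam S η)) +
        ∑ T ∈ P.powerset, ∑ p ∈ arrangements T, if (y :: (p ++ [y])).IsChain r then
        lam (y :: (p ++ [y])) * coeff n (walkSeries r lam S (η ++ y :: p)) else 0 := by
      rw [walkSeries_concat hrot h, map_add, coeff_succ_X_mul, map_sum]
      congr 1
      · split_ifs
        · simp [coeff_one]
        · rw [coeff_succ_X_mul]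
      · refine Finset.sum_congr rfl fun T _ => ?_
        rw [map_sum]
        refine Finset.sum_congr rfl fun p _ => ?_
        split_ifs
        · rw [coeff_C_mul]
        · simp
    have hη : η ≠ [] → IsSAWIn r S η := fun h0 =>
      ⟨h0, (List.nodup_append.1 h.nodup).1, h.isChain.left_of_append,
        fun x hx => h.mem x (by simp [hx])⟩
    have hnn1 : 0 ≤ (if η = [] then 0 else coeff n (walkSeries r lam S η)) := by
      split_ifs with h0
      exacts [le_rfl, (ih η (hη h0)).2]
    have hnn2 : ∀ T ∈ P.powerset, ∀ p ∈ arrangements T, 0 ≤ if (y :: (p ++ [y])).IsChain r then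
        lam (y :: (p ++ [y])) * coeff n (walkSeries r lam S (η ++ y :: p)) else 0 := by
      intro T hT p hp
      split_ifs with hc
      exacts [mul_nonneg (NNReal.coe_nonneg _) (ih _ (hsaw T hT p hp hc)).2, le_rfl]
    have hnn3 : ∀ T ∈ P.powerset, 0 ≤ ∑ p ∈ arrangements T, if (y :: (p ++ [y])).IsChain r then
        lam (y :: (p ++ [y])) * coeff n (walkSeries r lam S (η ++ y :: p)) else 0 :=
      fun T hT => Finset.sum_nonneg (hnn2 T hT)
    rw [walkSum_succ h, hsum, hcoeff]
    refine ⟨?_, add_nonneg hnn1 (Finset.sum_nonneg hnn3)⟩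
    rw [ENNReal.ofReal_add hnn1 (Finset.sum_nonneg hnn3), ENNReal.ofReal_sum_of_nonneg hnn3]
    congr 1
    · split_ifs with h0
      · simp
      · exact (ih η (hη h0)).1
    · refine Finset.sum_congr rfl fun T hT => ?_
      rw [ENNReal.ofReal_sum_of_nonneg (hnn2 T hT)]
      refine Finset.sum_congr rfl fun p hp => ?_
      split_ifs with hc
      · rw [(ih _ (hsaw T hT p hp hc)).1, ENNReal.ofReal_mul (NNReal.coe_nonneg _),
          ENNReal.ofReal_coe_nnreal]
      · simp

end FiniteVolume

section LoopSum

open PowerSeries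

variable {α : Type*} [DecidableEq α] (r : α → α → Prop) (lam : List α → ℝ≥0)

/-- The total activity of the `n`-step closed walks inside `S` that visit `A`, for `n ≥ 1`. -/
def loopSum (S : Finset α) (n : ℕ) (A : Finset α) : ℝ≥0∞ :=
  ∑' l : List α, if IsWalkIn r S n l ∧ (1 ≤ n ∧ l.head? = l.getLast? ∧ ∃ x ∈ l, x ∈ A)
    then activity lam (erasedLoops l) else 0

/-- The generating function of the closed walks in `S`. -/
def loopSeries (S : Finset α) : ℝ⟦X⟧ := ∑ y ∈ S, walkSeries r lam S [y] - (S.card : ℝ⟦X⟧)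

variable {r lam}

theorem loopSum_zero (S A : Finset α) : loopSum r lam S 0 A = 0 := by
  simp [loopSum]

theorem loopSum_self (S : Finset α) {n : ℕ} (hn : 1 ≤ n) :
    loopSum r lam S n S = ∑ y ∈ S, walkSum r lam S n [y] := by
  simp only [walkSum]
  rw [← Summable.tsum_finsetSum fun _ _ => ENNReal.summable]
  refine tsum_congr fun l => ?_
  by_cases hl : IsWalkIn r S n l
  swap
  · simp [hl]
  obtain ⟨x, l', rfl⟩ := List.exists_cons_of_ne_nil hl.ne_nil
  have hx : x ∈ S := hl.2.2 x (by simp)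
  rw [Finset.sum_eq_single x]
  · congr 1
    simp only [hl, true_and, LE_eq_singleton_iff, hn, List.head?_cons, eq_iff_iff, eq_comm]
    exact ⟨fun h => ⟨h, x, by simp, hx⟩, fun h => h.1⟩
  · intro y _ hyx
    rw [if_neg]
    rintro ⟨-, h⟩
    rw [LE_eq_singleton_iff] at h
    exact hyx (by simpa using h.1.symm)
  · exact fun h => absurd hx h

theorem loopSum_add_loopSum_sdiff (S : Finset α) (n : ℕ) {A : Finset α} (hA : A ⊆ S) :
    loopSum r lam S n A + loopSum r lam (S \ A) n (S \ A) = loopSum r lam S n S := by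
  rw [loopSum, loopSum, loopSum, ← ENNReal.tsum_add]
  refine tsum_congr fun l => ?_
  by_cases hl : IsWalkIn r S n l
  swap
  · have : ¬ IsWalkIn r (S \ A) n l := fun h =>
      hl ⟨h.1, h.2.1, fun x hx => (Finset.mem_sdiff.1 (h.2.2 x hx)).1⟩
    simp [hl, this]
  obtain ⟨x, l', hxl⟩ := List.exists_cons_of_ne_nil hl.ne_nil
  have hx : x ∈ l := by simp [hxl]
  by_cases hlA : ∃ x ∈ l, x ∈ A
  · have h1 : ¬ IsWalkIn r (S \ A) n l := fun h => by
      obtain ⟨x, hx, hxA⟩ := hlA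
      exact (Finset.mem_sdiff.1 (h.2.2 x hx)).2 hxA
    have h2 : ∃ x ∈ l, x ∈ S := by
      obtain ⟨x, hx, hxA⟩ := hlA
      exact ⟨x, hx, hA hxA⟩
    simp only [hl, hlA, h1, h2, false_and, if_false, add_zero]
  · have h1 : ∀ x ∈ l, x ∈ S \ A := fun x hx =>
      Finset.mem_sdiff.2 ⟨hl.2.2 x hx, fun h => hlA ⟨x, hx, h⟩⟩
    have h2 : IsWalkIn r (S \ A) n l := ⟨hl.1, hl.2.1, h1⟩
    have h3 : ∃ x ∈ l, x ∈ S \ A := ⟨x, hx, h1 x hx⟩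
    have h4 : ∃ x ∈ l, x ∈ S := ⟨x, hx, hl.2.2 x hx⟩
    simp only [hl, hlA, h2, h3, h4, and_false, if_false, zero_add]

theorem loopSum_self_eq_coeff (hrot : RotationInvariant r lam) (S : Finset α) {n : ℕ}
    (hn : 1 ≤ n) : loopSum r lam S n S = ENNReal.ofReal (coeff n (loopSeries r lam S)) ∧
      0 ≤ coeff n (loopSeries r lam S) := by
  have hsaw : ∀ y ∈ S, IsSAWIn r S [y] := fun y hy => ⟨by simp, by simp, by simp, by simpa⟩
  have hc : coeff n (loopSeries r lam S) = ∑ y ∈ S, coeff n (walkSeries r lam S [y]) := by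
    rw [loopSeries, map_sub, map_sum, ← map_natCast (C (R := ℝ)) S.card, coeff_C,
      if_neg (by omega), sub_zero]
  have hnn : ∀ y ∈ S, 0 ≤ coeff n (walkSeries r lam S [y]) := fun y hy =>
    (walkSum_eq_coeff hrot S n [y] (hsaw y hy)).2
  rw [hc]
  refine ⟨?_, Finset.sum_nonneg hnn⟩
  rw [loopSum_self S hn, ENNReal.ofReal_sum_of_nonneg hnn]
  exact Finset.sum_congr rfl fun y hy => (walkSum_eq_coeff hrot S n [y] (hsaw y hy)).1

theorem loopSum_eq_coeff (hrot : RotationInvariant r lam) {S A : Finset α} (hA : A ⊆ S) {n : ℕ}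
    (hn : 1 ≤ n) :
    loopSum r lam S n A =
        ENNReal.ofReal (coeff n (loopSeries r lam S - loopSeries r lam (S \ A))) ∧
      0 ≤ coeff n (loopSeries r lam S - loopSeries r lam (S \ A)) := by
  have h := loopSum_add_loopSum_sdiff (r := r) (lam := lam) S n hA
  obtain ⟨h1, h1'⟩ := loopSum_self_eq_coeff hrot S hn
  obtain ⟨h2, h2'⟩ := loopSum_self_eq_coeff hrot (S \ A) hn
  rw [h1, h2] at h
  rw [map_sub]
  constructor
  · rw [ENNReal.ofReal_sub _ h2', ← h]
    exact (ENNReal.add_sub_cancel_right ENNReal.ofReal_ne_top).symm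
  · rw [sub_nonneg, ← ENNReal.ofReal_le_ofReal_iff h1', ← h]
    exact le_add_self

theorem constantCoeff_inv_polygonXi (S : Finset α) :
    constantCoeff ((polygonXi r lam S)⁻¹) = (1 : ℝ) := by
  have := congrArg constantCoeff (polygonXi_mul_inv (r := r) (lam := lam) S)
  rwa [map_mul, constantCoeff_polygonXi, one_mul, map_one] at this

theorem constantCoeff_loopSeries (S : Finset α) : constantCoeff (loopSeries r lam S) = 0 := by
  simp [loopSeries, walkSeries, constantCoeff_polygonXi]

theorem eulerDerivation_polygonXi (S : Finset α) :
    eulerDerivation (polygonXi r lam S) = - (polygonXi r lam S * loopSeries r lam S) := by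
  have h := polygonXi_eulerDerivation (r := r) (lam := lam) S
  have h1 : polygonXi r lam S * ∑ y ∈ S, walkSeries r lam S [y] =
      ∑ y ∈ S, polygonXi r lam (S.erase y) := by
    rw [Finset.mul_sum]
    refine Finset.sum_congr rfl fun y _ => ?_
    have h2 : S \ [y].toFinset = S.erase y := by
      ext x
      simp [and_comm]
    rw [walkSeries, h2]
    simp only [List.length_singleton, Nat.sub_self, pow_zero, one_mul]
    rw [mul_left_comm, polygonXi_mul_inv, mul_one]
  rw [loopSeries, mul_sub, h1, ← h]
  ring

theorem eulerDerivation_polygonXi_div (S A : Finset α) :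
    eulerDerivation (polygonXi r lam (S \ A) * (polygonXi r lam S)⁻¹) =
      polygonXi r lam (S \ A) * (polygonXi r lam S)⁻¹ *
        (loopSeries r lam S - loopSeries r lam (S \ A)) := by
  set Q := polygonXi r lam (S \ A) * (polygonXi r lam S)⁻¹ with hQ
  have h1 : polygonXi r lam S * (polygonXi r lam S)⁻¹ = 1 := polygonXi_mul_inv S
  have h2 : Q * polygonXi r lam S = polygonXi r lam (S \ A) := by
    rw [hQ, mul_assoc, mul_comm _ (polygonXi r lam S), h1, mul_one]
  have h3 := congrArg eulerDerivation h2
  rw [Derivation.leibniz, eulerDerivation_polygonXi, eulerDerivation_polygonXi, ← h2, smul_eq_mul,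
    smul_eq_mul] at h3
  have h4 : polygonXi r lam S * eulerDerivation Q =
      polygonXi r lam S * (Q * (loopSeries r lam S - loopSeries r lam (S \ A))) := by
    linear_combination h3
  have h5 := congrArg (fun f => f * (polygonXi r lam S)⁻¹) h4
  linear_combination h5 + (Q * (loopSeries r lam S - loopSeries r lam (S \ A)) -
    eulerDerivation Q) * h1

/-- The finite volume identity for the loop-erased weight. -/
theorem tsum_walkSum_eq (hrot : RotationInvariant r lam) {S : Finset α} {η : List α}
    (h : IsSAWIn r S η) (z : ℝ≥0∞) :
    ∑' n : ℕ, z ^ n * walkSum r lam S n η =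
      z ^ (η.length - 1) * eexp (∑' n : ℕ, z ^ n / n * loopSum r lam S n η.toFinset) := by
  set k := η.length - 1 with hk
  set A := η.toFinset with hA
  have hAS : A ⊆ S := fun x hx => h.mem x (List.mem_toFinset.1 hx)
  set Q := polygonXi r lam (S \ A) * (polygonXi r lam S)⁻¹ with hQ
  have hW := fun n => walkSum_eq_coeff hrot S n η h
  rw [show walkSeries r lam S η = X ^ k * Q from rfl] at hW
  have hQc : ∀ n, coeff (n + k) (X ^ k * Q) = coeff n Q := fun n => coeff_X_pow_mul Q k n
  have hQ0 : ∀ n, 0 ≤ coeff n Q := fun n => hQc n ▸ (hW (n + k)).2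
  have hshift : ∑' n : ℕ, z ^ n * walkSum r lam S n η =
      z ^ k * ∑' n : ℕ, z ^ n * ENNReal.ofReal (coeff n Q) := by
    rw [← Summable.sum_add_tsum_nat_add' (k := k) ENNReal.summable, Finset.sum_eq_zero, zero_add,
      ← ENNReal.tsum_mul_left]
    · refine tsum_congr fun n => ?_
      rw [(hW _).1, hQc, pow_add]
      ring
    · intro n hn
      rw [(hW n).1, coeff_X_pow_mul', if_neg (by simpa using hn)]
      simp
  rw [hshift]
  congr 1
  rw [tsum_eq_eexp _ (fun n => z ^ n * loopSum r lam S n A)]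
  · congr 1
    refine tsum_congr fun n => ?_
    rw [ENNReal.mul_div_right_comm]
  · rw [hQ, coeff_zero_eq_constantCoeff, map_mul, constantCoeff_polygonXi,
      constantCoeff_inv_polygonXi]
    simp
  · rw [loopSum_zero, mul_zero]
  · intro n
    have hE := congrArg (coeff n) (eulerDerivation_polygonXi_div (r := r) (lam := lam) S A)
    rw [← hQ, coeff_eulerDerivation] at hE
    set L := loopSeries r lam S - loopSeries r lam (S \ A) with hL
    rw [coeff_mul n Q L] at hE
    have hterm : ∀ p ∈ Finset.HasAntidiagonal.antidiagonal n,
        z ^ p.1 * ENNReal.ofReal (coeff p.1 Q) * (z ^ p.2 * loopSum r lam S p.2 A) =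
          z ^ n * ENNReal.ofReal (coeff p.1 Q * coeff p.2 L) ∧ 0 ≤ coeff p.1 Q * coeff p.2 L := by
      rintro ⟨i, j⟩ hij
      rw [Finset.HasAntidiagonal.mem_antidiagonal] at hij
      have hj : loopSum r lam S j A = ENNReal.ofReal (coeff j L) ∧ 0 ≤ coeff j L := by
        rcases Nat.eq_zero_or_pos j with rfl | hj
        · rw [hL, coeff_zero_eq_constantCoeff, map_sub, constantCoeff_loopSeries,
            constantCoeff_loopSeries, loopSum_zero]
          simp
        · exact loopSum_eq_coeff hrot hAS hj
      refine ⟨?_, mul_nonneg (hQ0 i) hj.2⟩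
      rw [hj.1, ENNReal.ofReal_mul (hQ0 i), ← hij, pow_add]
      ring
    rw [Finset.sum_congr rfl fun p hp => (hterm p hp).1, ← Finset.mul_sum,
      ← ENNReal.ofReal_sum_of_nonneg fun p hp => (hterm p hp).2, ← hE,
      ENNReal.ofReal_mul (Nat.cast_nonneg n), ENNReal.ofReal_natCast]
    ring

end LoopSum

section InfiniteVolume

open Filter Topology

theorem tendsto_tsum_list {α : Type*} (g : List α → ℝ≥0∞) :
    Tendsto (fun S : Finset α => ∑' l, if ∀ x ∈ l, x ∈ S then g l else 0) atTop
      (𝓝 (∑' l, g l)) := by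
  refine tendsto_atTop_isLUB (fun S S' hS => ENNReal.tsum_le_tsum fun l => ?_) ⟨?_, ?_⟩
  · split_ifs with h1 h2
    exacts [le_rfl, absurd (fun x hx => hS (h1 x hx)) h2, zero_le, le_rfl]
  · rintro _ ⟨S, rfl⟩
    refine ENNReal.tsum_le_tsum fun l => ?_
    split_ifs
    exacts [le_rfl, zero_le]
  · intro b hb
    rw [ENNReal.tsum_eq_iSup_sum]
    refine iSup_le fun s => le_trans ?_ (hb ⟨s.biUnion List.toFinset, rfl⟩)
    refine le_trans (Finset.sum_le_sum fun l hl => ?_) (ENNReal.sum_le_tsum s)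
    rw [if_pos]
    exact fun x hx => Finset.mem_biUnion.2 ⟨l, hl, List.mem_toFinset.2 hx⟩

theorem tsum_isWalkIn {α : Type*} (r : α → α → Prop) (S : Finset α) (c : ℕ → ℝ≥0∞)
    (P : ℕ → List α → Prop) [∀ n l, Decidable (P n l)] (a : List α → ℝ≥0∞) :
    ∑' n, c n * ∑' l, (if IsWalkIn r S n l ∧ P n l then a l else 0) =
      ∑' l, if ∀ x ∈ l, x ∈ S then
        (if l ≠ [] ∧ l.IsChain r then
          (if P (l.length - 1) l then c (l.length - 1) * a l else 0) else 0) else 0 := by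
  simp only [← ENNReal.tsum_mul_left]
  rw [ENNReal.tsum_comm]
  refine tsum_congr fun l => ?_
  rw [tsum_eq_single (l.length - 1)]
  · have h : IsWalkIn r S (l.length - 1) l ↔ (∀ x ∈ l, x ∈ S) ∧ l ≠ [] ∧ l.IsChain r := by
      refine ⟨fun h => ⟨h.2.2, h.ne_nil, h.1⟩, fun h => ⟨h.2.2, ?_, h.1⟩⟩
      have := List.length_pos_iff.2 h.2.1
      omega
    rw [mul_ite, mul_zero, ← ite_and, ← ite_and, h]
    congr 1
  · intro n hn
    rw [if_neg, mul_zero]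
    rintro ⟨h, -⟩
    have := h.2.1
    omega

theorem tsum_walk {d : ℕ} (g : List (Pt d) → ℝ≥0∞) :
    ∑' ω : Walk d, g ω.pts = ∑' l, if l ≠ [] ∧ l.IsChain Adj then g l else 0 := by
  have hinj : Function.Injective (Walk.pts : Walk d → List (Pt d)) := by
    rintro ⟨l, _, _⟩ ⟨l', _, _⟩ h
    simpa using h
  rw [← hinj.tsum_eq]
  · exact tsum_congr fun ω => (if_pos ⟨ω.ne, ω.chain⟩).symm
  · intro l hl
    by_contra h
    refine hl (if_neg fun h' => h ⟨⟨l, h'.1, h'.2⟩, rfl⟩)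

theorem tendsto_tsum_isWalkIn {d : ℕ} (c : ℕ → ℝ≥0∞) (P : ℕ → List (Pt d) → Prop)
    [∀ n l, Decidable (P n l)] (a : List (Pt d) → ℝ≥0∞) :
    Tendsto (fun S : Finset (Pt d) =>
      ∑' n, c n * ∑' l, (if IsWalkIn Adj S n l ∧ P n l then a l else 0)) atTop
      (𝓝 (∑' ω : Walk d, if P ω.len ω.pts then c ω.len * a ω.pts else 0)) := by
  simp only [tsum_isWalkIn]
  rw [show (∑' ω : Walk d, if P ω.len ω.pts then c ω.len * a ω.pts else 0) = _ from
    tsum_walk fun l => if P (l.length - 1) l then c (l.length - 1) * a l else 0]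
  exact tendsto_tsum_list _

theorem eexp_eq_exp (x : ℝ≥0∞) : eexp x = EReal.exp x := by
  induction x with
  | top => simp [eexp]
  | coe x =>
    rw [eexp, if_neg ENNReal.coe_ne_top]
    rfl

theorem continuous_eexp : Continuous eexp := by
  rw [show eexp = fun x : ℝ≥0∞ => EReal.exp (x : EReal) from funext eexp_eq_exp]
  exact ENNReal.continuous_exp.comp continuous_coe_ennreal_ereal

theorem eexp_add (x y : ℝ≥0∞) : eexp (x + y) = eexp x * eexp y := by
  rw [eexp_eq_exp, eexp_eq_exp, eexp_eq_exp, EReal.coe_ennreal_add, EReal.exp_add]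

theorem eexp_mono {x y : ℝ≥0∞} (h : x ≤ y) : eexp x ≤ eexp y := by
  rw [eexp_eq_exp, eexp_eq_exp]
  exact EReal.exp_monotone (EReal.coe_ennreal_le_coe_ennreal_iff.2 h)

theorem rotationInvariant_of_symmAssumption {d : ℕ} {lam : List (Pt d) → ℝ≥0}
    (hsym : SymmAssumption lam) : RotationInvariant Adj lam := by
  intro x y a b hnd hc
  have h1 : x :: (a ++ y :: b ++ [x]) = (x :: a ++ y :: b) ++ [x] := by simp
  have h2 : IsSAPList (x :: (a ++ y :: b ++ [x])) := by
    refine ⟨hc, by simp; omega, ?_, ?_⟩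
    · rw [h1, List.getLastD_concat]
      rfl
    · rw [h1, List.dropLast_concat]
      simpa using hnd
  have h3 : polyRot (x :: (a ++ y :: b ++ [x])) (x :: a).length =
      y :: (b ++ x :: a ++ [y]) := by
    rw [polyRot, h1, List.dropLast_concat, List.rotate_append_length_eq]
    simp
  rw [← h3]
  exact hsym.2.1 _ h2 _

theorem Walk.isLoop_iff {d : ℕ} (ω : Walk d) :
    ω.IsLoop ↔ 1 ≤ ω.len ∧ ω.pts.head? = ω.pts.getLast? := by
  obtain ⟨l, hl, hc⟩ := ω
  obtain ⟨x, l, rfl⟩ := List.exists_cons_of_ne_nil hl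
  simp only [Walk.IsLoop, Walk.finish, Walk.start]
  rw [List.getLastD_eq_getLast?]
  simp [List.getLast?_cons, eq_comm]

theorem wbar_eq {d : ℕ} {lam : List (Pt d) → ℝ≥0} (hsym : SymmAssumption lam) (z : ℝ≥0)
    (η : Walk d) (hη : η.pts.Nodup) :
    wbar lam z η = (z : ℝ≥0∞) ^ η.len * eexp (mu lam z η.range ∅) := by
  have hW : Tendsto (fun S : Finset (Pt d) =>
      ∑' n : ℕ, (z : ℝ≥0∞) ^ n * walkSum Adj lam S n η.pts) atTop (𝓝 (wbar lam z η)) :=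
    tendsto_tsum_isWalkIn (fun n => (z : ℝ≥0∞) ^ n) (fun _ l => LE l = η.pts)
      fun l => activity lam (erasedLoops l)
  have hM : Tendsto (fun S : Finset (Pt d) =>
      ∑' n : ℕ, (z : ℝ≥0∞) ^ n / n * loopSum Adj lam S n η.pts.toFinset) atTop
      (𝓝 (mu lam z η.range ∅)) := by
    have h := tendsto_tsum_isWalkIn (d := d) (fun n => (z : ℝ≥0∞) ^ n / n)
      (fun n l => 1 ≤ n ∧ l.head? = l.getLast? ∧ ∃ x ∈ l, x ∈ η.pts.toFinset)
      fun l => activity lam (erasedLoops l)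
    refine (congrArg (fun t => Tendsto _ atTop (𝓝 t)) ?_).mp h
    refine tsum_congr fun ω => ?_
    have hiff : (1 ≤ ω.len ∧ ω.pts.head? = ω.pts.getLast? ∧ ∃ x ∈ ω.pts, x ∈ η.pts.toFinset) ↔
        (ω.IsLoop ∧ (ω.range ∩ η.range).Nonempty ∧ ω.range ∩ ∅ = ∅) := by
      rw [Walk.isLoop_iff, and_assoc]
      simp only [List.mem_toFinset, Set.inter_empty, and_true]
      rfl
    simp only [hiff]
    congr 1
    rw [wt, ENNReal.mul_div_right_comm]
    rfl
  refine tendsto_nhds_unique hW (Tendsto.congr' ?_ (ENNReal.Tendsto.const_mul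
    ((continuous_eexp.tendsto _).comp hM) (Or.inr (ENNReal.pow_ne_top ENNReal.coe_ne_top))))
  filter_upwards [eventually_ge_atTop η.pts.toFinset] with S hS
  exact (tsum_walkSum_eq (rotationInvariant_of_symmAssumption hsym)
    ⟨η.ne, hη, η.chain, fun x hx => hS (List.mem_toFinset.2 hx)⟩ z).symm

theorem mu_union {d : ℕ} (lam : List (Pt d) → ℝ≥0) (z : ℝ≥0) (A B : Set (Pt d)) :
    mu lam z (A ∪ B) ∅ = mu lam z A ∅ + mu lam z B A := by
  rw [mu, mu, mu, ← ENNReal.tsum_add]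
  refine tsum_congr fun ω => ?_
  simp only [Set.inter_empty, and_true, Set.inter_union_distrib_left, Set.union_nonempty]
  rcases (ω.range ∩ A).eq_empty_or_nonempty with h | h
  · simp [h]
  · simp [h, h.ne_empty]

theorem mu_le_mu_empty {d : ℕ} (lam : List (Pt d) → ℝ≥0) (z : ℝ≥0) (A B : Set (Pt d)) :
    mu lam z A B ≤ mu lam z A ∅ := by
  refine ENNReal.tsum_le_tsum fun ω => ?_
  split_ifs with h1 h2
  · exact le_rfl
  · exact absurd ⟨h1.1, h1.2.1, Set.inter_empty _⟩ h2
  · exact zero_le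
  · exact le_rfl

end InfiniteVolume

/-- **Loop-erased λ-LWW is purely repulsive.**  Let `λ` be nonnegative loop activities
satisfying the symmetry assumption and `z ≥ 0`.  If `η₁` is a self-avoiding walk ending
at the starting vertex of a self-avoiding walk `η₂`, and the concatenation
`η = η₁ ∘ η₂` is self-avoiding, then
`w̄_{λ,z}(η) = z^{|η₁|}·z^{|η₂|}·exp(μ_{λ,z}(range η₁))·exp(μ_{λ,z}(range η₂; range η₁))`,
and consequently `w̄_{λ,z}(η₁∘η₂) ≤ w̄_{λ,z}(η₁)·w̄_{λ,z}(η₂)` (in `[0,∞]`). -/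
theorem loopErased_purely_repulsive {d : ℕ} (lam : List (Pt d) → ℝ≥0) (z : ℝ≥0)
    (hsym : SymmAssumption lam) (η η₁ η₂ : Walk d)
    (h₁ : η₁.pts.Nodup) (h₂ : η₂.pts.Nodup) (hend : η₁.finish = η₂.start)
    (hcat : η.pts = η₁.pts ++ η₂.pts.tail) (hsa : η.pts.Nodup) :
    wbar lam z η
        = (z : ℝ≥0∞) ^ η₁.len * (z : ℝ≥0∞) ^ η₂.len * eexp (mu lam z η₁.range ∅)
          * eexp (mu lam z η₂.range η₁.range)
      ∧ wbar lam z η ≤ wbar lam z η₁ * wbar lam z η₂ := by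
  obtain ⟨y, t, hy⟩ := List.exists_cons_of_ne_nil η₂.ne
  have hpos := List.length_pos_iff.2 η₁.ne
  have hlen : η.len = η₁.len + η₂.len := by
    simp only [Walk.len, hcat, hy, List.length_append, List.tail_cons, List.length_cons]
    omega
  have hy₁ : y ∈ η₁.pts := by
    rw [Walk.finish, Walk.start, hy, List.getLastD_eq_getLast?,
      List.getLast?_eq_getLast_of_ne_nil η₁.ne] at hend
    simp only [Option.getD_some, List.headI_cons] at hend
    rw [← hend]
    exact List.getLast_mem η₁.ne
  have hrange : η.range = η₁.range ∪ η₂.range := by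
    ext x
    simp only [Walk.range, hcat, hy, List.tail_cons, List.mem_append, List.mem_cons,
      Set.mem_union, Set.mem_ofPred_eq]
    constructor
    · rintro (h | h)
      exacts [Or.inl h, Or.inr (Or.inr h)]
    · rintro (h | rfl | h)
      exacts [Or.inl h, Or.inl hy₁, Or.inr h]
  have hmain : wbar lam z η
      = (z : ℝ≥0∞) ^ η₁.len * (z : ℝ≥0∞) ^ η₂.len * eexp (mu lam z η₁.range ∅)
        * eexp (mu lam z η₂.range η₁.range) := by
    rw [wbar_eq hsym z η hsa, hrange, mu_union, eexp_add, hlen, pow_add, mul_assoc, mul_assoc,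
      mul_assoc]
  refine ⟨hmain, ?_⟩
  rw [hmain, wbar_eq hsym z η₁ h₁, wbar_eq hsym z η₂ h₂, mul_mul_mul_comm, ← mul_assoc]
  exact mul_le_mul_right (eexp_mono (mu_le_mu_empty lam z _ _)) _

end LWW
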